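/- Let h be a Hessenberg function on {1,…,n} and μ a composition of n. Then the family of functions {v · f_μ : v ∈ S_n^μ}, indexed by the shortest left coset representatives v ∈ S_n^μ, is linearly independent over R, where functions S_n → R are regarded as elements of the free R-module of all functions from S_n to R. Moreover, the stabilizer of f_μ under the dot action is exactly S_μ, i.e., {v ∈ S_n : v · f_μ = f_μ} = S_μ. -/

import Mathlib

open MvPolynomial Finset

/-- Partial sums of a composition: `psum μ i = μ 0 + ⋯ + μ (i-1)` (so `psum μ i = [μ]_i`). -/
def psum (μ : ℕ → ℕ) (i : ℕ) : ℕ := ∑ t ∈ Finset.range i, μ t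

/-- Membership in the Young subgroup `S_μ` (0-based): `y` maps each block
`{psum μ b, …, psum μ (b+1) - 1}` (for `b < L`) to itself. -/
def YoungC {n : ℕ} (μ : ℕ → ℕ) (L : ℕ) (y : Equiv.Perm (Fin n)) : Prop :=
  ∀ b, b < L → ∀ p : Fin n, psum μ b ≤ (p : ℕ) → (p : ℕ) < psum μ (b + 1) →
    psum μ b ≤ (y p : ℕ) ∧ (y p : ℕ) < psum μ (b + 1)

/-- `v` is the permutation `v_μ`, defined (1-based) by
`v_μ([μ']_{ℓ-i-1} + j) = [μ]_i + j` for `0 ≤ i ≤ ℓ-1`, `1 ≤ j ≤ μ_{i+1}`,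
written with 0-based indices. -/
def IsVmu {n : ℕ} (μ : ℕ → ℕ) (L : ℕ) (v : Equiv.Perm (Fin n)) : Prop :=
  ∀ i, i < L → ∀ j, j < μ i →
    ∀ (hp : psum (fun t => μ (L - 1 - t)) (L - 1 - i) + j < n) (hq : psum μ i + j < n),
      v ⟨psum (fun t => μ (L - 1 - t)) (L - 1 - i) + j, hp⟩ = ⟨psum μ i + j, hq⟩

/-- The set `N_h^-(v) = {(i,j) : j < i, v(i) < v(j), i ≤ h(j)}`. -/
def NhSet {n : ℕ} (h : Fin n → Fin n) (v : Equiv.Perm (Fin n)) : Finset (Fin n × Fin n) :=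
  Finset.univ.filter fun p => p.2 < p.1 ∧ v p.1 < v p.2 ∧ p.1 ≤ h p.2

/- The top-coset class `f_μ`:  `f_μ(w) = ∏_{(i,j) ∈ N_h^-(v_μ)} (t_{w(i)} - t_{w(j)})` if
`w ∈ S_μ v_μ`, and `f_μ(w) = 0` otherwise. -/
open Classical in
noncomputable def topClass {n : ℕ} (h : Fin n → Fin n) (μ : ℕ → ℕ) (L : ℕ)
    (vmu : Equiv.Perm (Fin n)) : Equiv.Perm (Fin n) → MvPolynomial (Fin n) ℂ :=
  fun w =>
    if ∃ y, YoungC μ L y ∧ w = y * vmu then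
      ∏ p ∈ NhSet h vmu, (X (w p.1) - X (w p.2))
    else 0

/-- The dot action `(v · f)(w) = v(f(v⁻¹ w))`. -/
noncomputable def dot {n : ℕ} (v : Equiv.Perm (Fin n))
    (f : Equiv.Perm (Fin n) → MvPolynomial (Fin n) ℂ) :
    Equiv.Perm (Fin n) → MvPolynomial (Fin n) ℂ :=
  fun w => rename (⇑v) (f (v⁻¹ * w))

/-- `v ∈ S_n^μ`, the shortest left coset representatives of `S_n / S_μ`:
`v(p) < v(p+1)` whenever `p+1` is not one of the partial sums `[μ]_b`, `b < L`. -/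
def ShortLeftC {n : ℕ} (μ : ℕ → ℕ) (L : ℕ) (v : Equiv.Perm (Fin n)) : Prop :=
  ∀ p q : Fin n, (p : ℕ) + 1 = (q : ℕ) → (∀ b, b < L → (q : ℕ) ≠ psum μ b) → v p < v q

/-- `v ∈ ^μS_n`, the shortest right coset representatives of `S_μ \ S_n`:
`v⁻¹(p) < v⁻¹(p+1)` whenever `p+1` is not one of the partial sums `[μ]_b`, `b < L`. -/
def ShortRightC {n : ℕ} (μ : ℕ → ℕ) (L : ℕ) (v : Equiv.Perm (Fin n)) : Prop :=
  ∀ p q : Fin n, (p : ℕ) + 1 = (q : ℕ) → (∀ b, b < L → (q : ℕ) ≠ psum μ b) → v⁻¹ p < v⁻¹ q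

theorem psum_mono (μ : ℕ → ℕ) : Monotone (psum μ) := fun _ _ hab =>
  Finset.sum_le_sum_of_subset (Finset.range_mono hab)

/-- Every `m < psum μ L` lies in one of the first `L` blocks. -/
theorem exists_block {μ : ℕ → ℕ} {L m : ℕ} (hm : m < psum μ L) :
    ∃ b < L, psum μ b ≤ m ∧ m < psum μ (b + 1) := by
  induction L with
  | zero => simp [_root_.psum] at hm
  | succ L ih =>
    rcases lt_or_ge m (psum μ L) with hlt | hge
    · obtain ⟨b, hb, hb'⟩ := ih hlt
      exact ⟨b, by omega, hb'⟩
    · exact ⟨L, by omega, hge, hm⟩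

theorem block_unique {μ : ℕ → ℕ} {b c m : ℕ} (hb : psum μ b ≤ m) (hb' : m < psum μ (b + 1))
    (hc : psum μ c ≤ m) (hc' : m < psum μ (c + 1)) : b = c :=
  le_antisymm
    (Nat.lt_succ_iff.1 ((psum_mono μ).reflect_lt (hb.trans_lt hc')))
    (Nat.lt_succ_iff.1 ((psum_mono μ).reflect_lt (hc.trans_lt hb')))

section Young

variable {n L : ℕ} {μ : ℕ → ℕ}

theorem YoungC.one : YoungC μ L (1 : Equiv.Perm (Fin n)) :=
  fun _ _ _ h₁ h₂ => ⟨h₁, h₂⟩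

theorem YoungC.mul {x y : Equiv.Perm (Fin n)} (hx : YoungC μ L x) (hy : YoungC μ L y) :
    YoungC μ L (x * y) := fun b hb p h₁ h₂ =>
  hx b hb (y p) (hy b hb p h₁ h₂).1 (hy b hb p h₁ h₂).2

theorem YoungC.inv (htot : psum μ L = n) {y : Equiv.Perm (Fin n)} (hy : YoungC μ L y) :
    YoungC μ L y⁻¹ := by
  intro b hb p h₁ h₂
  obtain ⟨c, hc, h₃, h₄⟩ := exists_block (htot ▸ (y⁻¹ p).isLt : ((y⁻¹ p : Fin n) : ℕ) < psum μ L)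
  have hyc := hy c hc _ h₃ h₄
  rw [← Equiv.Perm.mul_apply, mul_inv_cancel, Equiv.Perm.one_apply] at hyc
  obtain rfl := block_unique h₁ h₂ hyc.1 hyc.2
  exact ⟨h₃, h₄⟩

/-- A shortest left coset representative is increasing on each block. -/
theorem ShortLeftC.lt_of_block {v : Equiv.Perm (Fin n)} (hv : ShortLeftC μ L v) {b : ℕ}
    {p q : Fin n} (hp : psum μ b ≤ p) (hpq : p < q) (hq : (q : ℕ) < psum μ (b + 1)) :
    v p < v q := by
  obtain ⟨q, hqn⟩ := q
  induction q with
  | zero => exact absurd hpq (Nat.not_lt_zero _)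
  | succ q ih =>
    have hpq' : (p : ℕ) < q + 1 := hpq
    simp only at hq
    have hstep : v ⟨q, by omega⟩ < v ⟨q + 1, hqn⟩ := by
      refine hv _ _ rfl fun c _ hc => ?_
      simp only at hc
      have h₁ : b < c := (psum_mono μ).reflect_lt (by omega)
      have h₂ : c < b + 1 := (psum_mono μ).reflect_lt (by omega)
      omega
    rcases Nat.lt_succ_iff_lt_or_eq.1 hpq' with hlt | heq
    · exact (ih (by omega) hlt (by simp only; omega)).trans hstep
    · have : p = ⟨q, by omega⟩ := Fin.ext heq
      rwa [this]

/-- A left coset of the Young subgroup has at most one shortest representative. -/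
theorem ShortLeftC.eq_of_mul_young (htot : psum μ L = n) {v w y : Equiv.Perm (Fin n)}
    (hv : ShortLeftC μ L v) (hw : ShortLeftC μ L w) (hy : YoungC μ L y) (hwv : w = v * y) :
    w = v := by
  suffices hfix : ∀ p, y p = p by
    rw [hwv, show y = 1 from Equiv.ext hfix, mul_one]
  intro p
  induction p using WellFoundedLT.induction with
  | ind p ih =>
    rcases lt_trichotomy (y p) p with hlt | heq | hgt
    · exact y.injective (ih _ hlt)
    · exact heq
    · exfalso
      obtain ⟨q, hq⟩ := y.surjective p
      have hpq : p < q := by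
        rcases lt_trichotomy p q with hlt | heq | hgt'
        · exact hlt
        · subst heq
          exact absurd hq hgt.ne'
        · exact absurd ((ih q hgt').symm.trans hq) hgt'.ne
      obtain ⟨c, hc, h₁, h₂⟩ := exists_block (htot ▸ q.isLt : (q : ℕ) < psum μ L)
      have hyq := hy c hc q h₁ h₂
      rw [hq] at hyq
      have hyp := hy c hc p hyq.1 hyq.2
      have hinc : w p < w q := hw.lt_of_block hyq.1 hpq h₂
      have hdec : v p < v (y p) := hv.lt_of_block hyq.1 hgt hyp.2
      rw [hwv, Equiv.Perm.mul_apply, Equiv.Perm.mul_apply, hq] at hinc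
      exact lt_asymm hinc hdec

end Young

section TopClass

variable {n L : ℕ} {μ : ℕ → ℕ} {h : Fin n → Fin n} {vmu : Equiv.Perm (Fin n)}

open Classical in
theorem dot_topClass_apply (v w : Equiv.Perm (Fin n)) :
    dot v (topClass h μ L vmu) w =
      if YoungC μ L (v⁻¹ * w * vmu⁻¹) then ∏ p ∈ NhSet h vmu, (X (w p.1) - X (w p.2)) else 0 := by
  have hiff : (∃ y, YoungC μ L y ∧ v⁻¹ * w = y * vmu) ↔ YoungC μ L (v⁻¹ * w * vmu⁻¹) := by
    constructor
    · rintro ⟨y, hy, hyw⟩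
      rwa [hyw, mul_inv_cancel_right]
    · exact fun hy => ⟨_, hy, by group⟩
  rw [dot, topClass, ← hiff]
  split_ifs <;> simp

theorem prod_NhSet_ne_zero (w : Equiv.Perm (Fin n)) :
    ∏ p ∈ NhSet h vmu, (X (w p.1) - X (w p.2) : MvPolynomial (Fin n) ℂ) ≠ 0 := by
  refine Finset.prod_ne_zero_iff.2 fun p hp => sub_ne_zero.2 fun heq => ?_
  have hlt : p.2 < p.1 := (Finset.mem_filter.1 hp).2.1
  exact hlt.ne' (w.injective (X_injective heq))

theorem dot_topClass_ne_zero_iff (v w : Equiv.Perm (Fin n)) :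
    dot v (topClass h μ L vmu) w ≠ 0 ↔ YoungC μ L (v⁻¹ * w * vmu⁻¹) := by
  rw [dot_topClass_apply]
  split_ifs with hy <;> simp [hy, prod_NhSet_ne_zero]

theorem dot_one (f : Equiv.Perm (Fin n) → MvPolynomial (Fin n) ℂ) : dot 1 f = f := by
  funext w
  simp [dot]

theorem dot_topClass_eq_iff (htot : psum μ L = n) (v : Equiv.Perm (Fin n)) :
    dot v (topClass h μ L vmu) = topClass h μ L vmu ↔ YoungC μ L v := by
  classical
  constructor
  · intro hv
    have hne : dot v (topClass h μ L vmu) (v * vmu) ≠ 0 := by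
      rw [dot_topClass_ne_zero_iff, inv_mul_cancel_left, mul_inv_cancel]
      exact YoungC.one
    rw [hv, ← dot_one (topClass h μ L vmu), dot_topClass_ne_zero_iff] at hne
    simpa using hne
  · intro hv
    conv_rhs => rw [← dot_one (topClass h μ L vmu)]
    funext w
    have hiff : YoungC μ L (v⁻¹ * w * vmu⁻¹) ↔ YoungC μ L (1⁻¹ * w * vmu⁻¹) := by
      rw [mul_assoc, inv_one, one_mul]
      exact ⟨fun hw => by simpa using hv.mul hw, fun hw => (hv.inv htot).mul hw⟩
    rw [dot_topClass_apply, dot_topClass_apply, if_congr hiff rfl rfl]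

theorem linearIndependent_dot_topClass (htot : psum μ L = n) :
    LinearIndependent (MvPolynomial (Fin n) ℂ)
      (fun v : {v : Equiv.Perm (Fin n) // ShortLeftC μ L v} =>
        dot v.1 (topClass h μ L vmu)) := by
  rw [linearIndependent_iff']
  intro s g hg v hv
  have hval := congrFun hg (v.1 * vmu)
  rw [Finset.sum_apply, Finset.sum_eq_single_of_mem v hv] at hval
  · refine (mul_eq_zero.1 hval).resolve_right ?_
    rw [← ne_eq, dot_topClass_ne_zero_iff, inv_mul_cancel_left, mul_inv_cancel]
    exact YoungC.one
  · intro u _ huv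
    have hzero : dot u.1 (topClass h μ L vmu) (v.1 * vmu) = 0 := by
      by_contra hne
      rw [← ne_eq, dot_topClass_ne_zero_iff, ← mul_assoc, mul_inv_cancel_right] at hne
      exact huv (Subtype.ext
        (u.2.eq_of_mul_young htot v.2 hne (mul_inv_cancel_left _ _).symm).symm)
    rw [Pi.smul_apply, hzero, smul_zero]

end TopClass

/-- Proposition 3.6 / `prop: top coset rep` and part of Lemma 3.4:
the `S_n`-orbit `{v · f_μ : v ∈ S_n^μ}` of the top-coset class is linearly independent over
`R = ℂ[t_1,…,t_n]`, and the stabilizer of `f_μ` under the dot action is exactly `S_μ`. -/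
theorem statement5 (n : ℕ) (h : Fin n → Fin n) (hmono : Monotone h) (hgrow : ∀ i, i ≤ h i)
    (μ : ℕ → ℕ) (L : ℕ) (hpos : ∀ i, i < L → 0 < μ i) (htot : psum μ L = n)
    (vmu : Equiv.Perm (Fin n)) (hvmu : IsVmu μ L vmu) :
    LinearIndependent (MvPolynomial (Fin n) ℂ)
      (fun v : {v : Equiv.Perm (Fin n) // ShortLeftC μ L v} =>
        dot v.1 (topClass h μ L vmu)) ∧
    (∀ v : Equiv.Perm (Fin n),
      dot v (topClass h μ L vmu) = topClass h μ L vmu ↔ YoungC μ L v) :=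
  ⟨linearIndependent_dot_topClass htot, dot_topClass_eq_iff htot⟩
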